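/- There exists a universal constant C > 0 such that the following holds. Let v* ∈ S^{d−1} be k-tree-sparse, let λ > 0, let x_1, …, x_n be spiked Wishart samples with spike v* and sample covariance Σ̂, and let v̂_TS be a maximizer of v ↦ vᵀ Σ̂ v over the set of k-tree-sparse unit vectors, chosen with ⟨v*, v̂_TS⟩ ≥ 0. Then for any c₁ > 0, with probability at least 1 − 2exp(−c₁ k), ‖v̂_TS − v*‖₂ ≤ C · ((1+λ)/λ) · √( (3 + ln 2 + c₁) k / n ). -/

import Mathlib

open MeasureTheory ProbabilityTheory Matrix Finset

noncomputable section

namespace StructuredPCA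

/-- Euclidean inner product on `Fin d → ℝ`. -/
def ip {d : ℕ} (u v : Fin d → ℝ) : ℝ := ∑ i, u i * v i

/-- Euclidean norm on `Fin d → ℝ`. -/
def nrm {d : ℕ} (v : Fin d → ℝ) : ℝ := Real.sqrt (∑ i, v i ^ 2)

/-- Quadratic form `vᵀ A v`. -/
def quad {d : ℕ} (A : Matrix (Fin d) (Fin d) ℝ) (v : Fin d → ℝ) : ℝ := ip v (A.mulVec v)

/-- `ρ(A, S) = sup { |vᵀ A v| : v ∈ S, ‖v‖ = 1 }`. -/
def rho {d : ℕ} (A : Matrix (Fin d) (Fin d) ℝ) (S : Set (Fin d → ℝ)) : ℝ :=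
  sSup {x : ℝ | ∃ v ∈ S, nrm v = 1 ∧ x = |quad A v|}

/-- Frobenius norm of a matrix. -/
def frob {d : ℕ} (A : Matrix (Fin d) (Fin d) ℝ) : ℝ :=
  Real.sqrt (∑ i, ∑ j, A i j ^ 2)

/-- Operator (spectral) norm of a matrix. -/
def opNorm {d : ℕ} (A : Matrix (Fin d) (Fin d) ℝ) : ℝ :=
  sSup {x : ℝ | ∃ v, nrm v = 1 ∧ x = nrm (A.mulVec v)}

/-- The spiked covariance `λ v* v*ᵀ + I`. -/
def spikedCov {d : ℕ} (lam : ℝ) (vstar : Fin d → ℝ) : Matrix (Fin d) (Fin d) ℝ :=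
  lam • vecMulVec vstar vstar + 1

/-- `x 1, …, x n` are spiked Wishart samples with spike `v*`:
`x i = √λ g i • v* + z i` with `g, z` i.i.d. standard normal, mutually independent. -/
def IsSpikedWishart {d n : ℕ} {Ω : Type*} [MeasurableSpace Ω] (μ : Measure Ω)
    (lam : ℝ) (vstar : Fin d → ℝ) (x : Fin n → Ω → Fin d → ℝ) : Prop :=
  ∃ G : (Fin n ⊕ Fin n × Fin d) → Ω → ℝ,
    (∀ i, Measurable (G i)) ∧
    iIndepFun G μ ∧
    (∀ i, μ.map (G i) = gaussianReal 0 1) ∧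
    ∀ i ω j, x i ω j = Real.sqrt lam * G (Sum.inl i) ω * vstar j + G (Sum.inr (i, j)) ω

/-- The sample covariance matrix `n⁻¹ ∑ xᵢ xᵢᵀ`. -/
def sampleCov {d n : ℕ} {Ω : Type*} (x : Fin n → Ω → Fin d → ℝ) (ω : Ω) :
    Matrix (Fin d) (Fin d) ℝ :=
  (n : ℝ)⁻¹ • ∑ i, vecMulVec (x i ω) (x i ω)

/-- Union-of-linear-structures data: an orthonormal basis `φ` and subsets `Bs m`. -/
structure UnionStruct (d M : ℕ) where
  φ : Fin d → Fin d → ℝ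
  orthonormal : ∀ i j, ip (φ i) (φ j) = if i = j then 1 else 0
  Bs : Fin M → Finset (Fin d)

/-- The subspace `L m = span (B m)`. -/
def UnionStruct.L {d M : ℕ} (U : UnionStruct d M) (m : Fin M) : Submodule ℝ (Fin d → ℝ) :=
  Submodule.span ℝ (U.φ '' (U.Bs m : Set (Fin d)))

/-- The union `𝓜 = ⋃ m, L m`. -/
def UnionStruct.carrier {d M : ℕ} (U : UnionStruct d M) : Set (Fin d → ℝ) :=
  ⋃ m, (U.L m : Set (Fin d → ℝ))

/-- A `(d,k)`-layered graph. -/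
structure LayeredGraph (d k : ℕ) where
  vs : Fin d
  vt : Fin d
  hst : vs ≠ vt
  V : Fin k → Finset (Fin d)
  hvs : ∀ j, vs ∉ V j
  hvt : ∀ j, vt ∉ V j
  hdisj : ∀ j j', j ≠ j' → Disjoint (V j) (V j')
  hdvd : k ∣ (d - 2)
  hcard : ∀ j, (V j).card = (d - 2) / k
  hcover : ∀ i, i ≠ vs → i ≠ vt → ∃ j, i ∈ V j

/-- A member of `P^k`: contains `v_s`, `v_t` and exactly one vertex of each layer. -/
def LayeredGraph.IsPathSet {d k : ℕ} (G : LayeredGraph d k) (P : Finset (Fin d)) : Prop :=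
  G.vs ∈ P ∧ G.vt ∈ P ∧ ∀ j, (P ∩ G.V j).card = 1

/-- `v` is `k`-path-sparse. -/
def LayeredGraph.PathSparse {d k : ℕ} (G : LayeredGraph d k) (v : Fin d → ℝ) : Prop :=
  ∃ P, G.IsPathSet P ∧ ∀ i, v i ≠ 0 → i ∈ P

/-- A member of `T^k`: a `k`-element rooted connected subtree of the complete binary
tree on nodes `1, …, d` (node `i ≥ 2` has parent `i / 2`). -/
def IsTreeSet (d k : ℕ) (T : Finset ℕ) : Prop :=
  T.card = k ∧ 1 ∈ T ∧ (∀ i ∈ T, 1 ≤ i ∧ i ≤ d) ∧ ∀ i ∈ T, 2 ≤ i → i / 2 ∈ T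

/-- `v` is `k`-tree-sparse (coordinate `i : Fin d` corresponds to node `i + 1`). -/
def TreeSparse (d k : ℕ) (v : Fin d → ℝ) : Prop :=
  ∃ T, IsTreeSet d k T ∧ ∀ i : Fin d, v i ≠ 0 → (i : ℕ) + 1 ∈ T

/-- The index of the parent node: coordinate `i` is node `i+1`, whose parent is `(i+1)/2`. -/
def parentIdx {d : ℕ} (i : Fin d) : Fin d :=
  ⟨((i : ℕ) + 1) / 2 - 1, by have := i.isLt; omega⟩

/-- The feasible set of the SDP relaxation for tree-sparse PCA. -/
def sdpFeasible (d k : ℕ) : Set (Matrix (Fin d) (Fin d) ℝ) :=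
  {Mm | Mm.PosSemidef ∧ (∑ i, Mm i i) = 1 ∧ (∑ i, ∑ j, |Mm i j|) ≤ (k : ℝ) ∧
    ∀ i : Fin d, 2 ≤ (i : ℕ) + 1 → Mm i i ≤ Mm (parentIdx i) (parentIdx i)}


lemma sq_exp_ineq {z : ℝ} (hz : |z| ≤ 1/2) : 1 / (1 - z) ≤ Real.exp (z + z^2) := by
  obtain ⟨h1, h2⟩ := abs_le.1 hz
  rw [div_le_iff₀ (by linarith)]
  rcases le_total 0 z with h | h
  · have := Real.quadratic_le_exp_of_nonneg (x := z + z^2) (by positivity)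
    have h3 : (1 + (z+z^2) + (z+z^2)^2/2) * (1 - z) ≤ Real.exp (z + z^2) * (1 - z) :=
      mul_le_mul_of_nonneg_right this (by linarith)
    have : (1 + (z+z^2) + (z+z^2)^2/2) * (1 - z) = 1 + z^2 * (1 - z - z^2 - z^3) / 2 := by ring
    have h4 : 0 ≤ z^2 * (1 - z - z^2 - z^3) := by
      apply mul_nonneg (sq_nonneg _)
      have : z^2 ≤ 1/4 := by nlinarith
      have : z^3 ≤ 1/8 := by nlinarith
      linarith
    linarith
  · have := Real.add_one_le_exp (z + z^2)
    have h3 : (z + z^2 + 1) * (1 - z) ≤ Real.exp (z + z^2) * (1 - z) :=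
      mul_le_mul_of_nonneg_right this (by linarith)
    nlinarith [mul_nonneg (neg_nonneg.2 h) (sq_nonneg z)]

lemma gaussian_sq_mgf (v : NNReal) (s : ℝ) (hs : |s * v| ≤ 1/4) :
    Integrable (fun y => Real.exp (s * y^2)) (gaussianReal 0 v) ∧
    ∫ y, Real.exp (s * y^2) ∂(gaussianReal 0 v) ≤ Real.exp (s * v + 2 * (s * v)^2) := by
  by_cases hv : v = 0
  · subst hv
    simp [gaussianReal_zero_var, integrable_dirac]
  have hv' : (0:ℝ) < v := by positivity
  obtain ⟨h1, h2⟩ := abs_le.1 hs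
  set b : ℝ := (1 - 2 * (s * v)) / (2 * v) with hb
  have hbpos : 0 < b := by apply div_pos <;> linarith
  have hfun : (fun y => gaussianPDFReal 0 v y * Real.exp (s * y^2)) =
      fun y => (√(2 * Real.pi * v))⁻¹ * Real.exp (-b * y^2) := by
    ext y
    rw [gaussianPDFReal, mul_assoc, ← Real.exp_add]
    congr 2
    rw [hb]; field_simp; ring
  constructor
  · rw [gaussianReal_of_var_ne_zero _ hv, integrable_withDensity_iff_integrable_smul' (measurable_gaussianPDF _ _) (by simp [gaussianPDF])]
    simp only [toReal_gaussianPDF, smul_eq_mul]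
    rw [hfun]
    exact (integrable_exp_neg_mul_sq hbpos).const_mul _
  · rw [integral_gaussianReal_eq_integral_smul hv]
    simp only [smul_eq_mul]
    rw [hfun, integral_const_mul, integral_gaussian]
    have e : (√(2 * Real.pi * v))⁻¹ * √(Real.pi / b) = √(1 / (1 - 2 * (s*v))) := by
      rw [← Real.sqrt_inv, ← Real.sqrt_mul (by positivity)]
      congr 1
      have : (1 - 2 * (s * v)) ≠ 0 := by linarith
      rw [hb]; field_simp
    rw [e]
    apply Real.sqrt_le_iff.2 ⟨(Real.exp_pos _).le, ?_⟩
    rw [← Real.exp_nat_mul]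
    refine (sq_exp_ineq (z := 2 * (s*v)) ?_).trans (le_of_eq ?_)
    · rw [abs_mul]; norm_num at hs ⊢; linarith
    · congr 1; push_cast; ring

lemma map_lin_comb {ι Ω : Type*} [MeasurableSpace Ω] {P : Measure Ω}
    {X : ι → Ω → ℝ} (hm : ∀ i, Measurable (X i)) (hi : iIndepFun X P)
    (hl : ∀ i, P.map (X i) = gaussianReal 0 1) (a : ι → ℝ) (s : Finset ι) :
    P.map (fun ω => ∑ j ∈ s, a j * X j ω) = gaussianReal 0 (∑ j ∈ s, a j ^ 2).toNNReal := by
  classical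
  have hP := hi.isProbabilityMeasure
  have hi' : iIndepFun (fun j ω => a j * X j ω) P :=
    hi.comp (fun j x => a j * x) (fun j => by fun_prop)
  induction s using Finset.induction_on with
  | empty => simp [Measure.map_const, gaussianReal_zero_var]
  | insert j s hj ih =>
    have hind := (hi'.indepFun_finsetSum_of_notMem (fun j => by have := hm j; fun_prop) hj).symm
    have h1 : P.map (fun ω => a j * X j ω) = gaussianReal 0 (a j ^ 2).toNNReal := by
      have := gaussianReal_map_const_mul (μ := 0) (v := 1) (a j)
      rw [← hl j, Measure.map_map (by fun_prop) (hm j)] at this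
      rw [show (fun ω => a j * X j ω) = (a j * ·) ∘ X j from rfl, this]
      congr 1
      · simp
      · ext; simp [sq_nonneg]
    have hs : (∑ j ∈ s, fun ω => a j * X j ω) = fun ω => ∑ j ∈ s, a j * X j ω := by
      ext; simp
    rw [hs] at hind
    have := gaussianReal_add_gaussianReal_of_indepFun hind h1 ih
    simp_rw [Finset.sum_insert hj]
    rw [Real.toNNReal_add (sq_nonneg _) (Finset.sum_nonneg fun _ _ => sq_nonneg _)]
    rw [add_zero] at this
    exact this

lemma block_indep {ι κ Ω : Type*} [Fintype ι] [Fintype κ] [MeasurableSpace Ω] {P : Measure Ω}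
    {X : ι → κ → Ω → ℝ} (hm : ∀ i j, Measurable (X i j))
    (hi : iIndepFun (fun p : (_ : ι) × κ => X p.1 p.2) P) :
    iIndepFun (fun i ω j => X i j ω) P := by
  have hP := hi.isProbabilityMeasure
  have : ∀ i j, IsProbabilityMeasure (P.map (X i j)) :=
    fun i j ↦ Measure.isProbabilityMeasure_map (hm i j).aemeasurable
  rw [iIndepFun_iff_map_fun_eq_infinitePi_map (by fun_prop)]
  have h0 := hi.map_fun_eq_infinitePi_map (fun p => hm _ _)
  have h1 : ∀ i, P.map (fun ω j => X i j ω) = Measure.infinitePi (fun j => P.map (X i j)) := fun i =>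
    (hi.precomp (g := fun j => (⟨i, j⟩ : (_ : ι) × κ)) (by intro a b; simp)).map_fun_eq_infinitePi_map
      (fun j => hm _ _)
  simp_rw [h1]
  rw [← Measure.infinitePi_map_piCurry (fun i j => P.map (X i j)), ← h0, Measure.map_map (by fun_prop) (by fun_prop)]
  rfl

lemma tail_one {n : ℕ} {Ω : Type*} [MeasurableSpace Ω] {P : Measure Ω}
    {Y : Fin n → Ω → ℝ} (hm : ∀ i, Measurable (Y i)) (hi : iIndepFun Y P) (v : NNReal)
    (hl : ∀ i, P.map (Y i) = gaussianReal 0 v) (L τ e : ℝ) (hL : 0 < L) (hv : (v : ℝ) ≤ L)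
    (hτ : 0 ≤ τ) (hτ1 : τ ≤ 1) (he : e ^ 2 = 1) :
    P.real {ω | n * L * τ ≤ e * (∑ i, (Y i ω)^2 - n * v)} ≤ Real.exp (-(n * τ^2 / 8)) := by
  have hP := hi.isProbabilityMeasure
  have hea : |e| = 1 := by
    rw [← sq_abs] at he
    nlinarith [abs_nonneg e]
  set t : ℝ := τ / (4 * L) with ht
  have ht0 : 0 ≤ t := by positivity
  have htv : t * v ≤ τ / 4 := by
    rw [ht, div_mul_eq_mul_div, div_le_div_iff₀ (by positivity) (by norm_num)]
    nlinarith
  have htv0 : 0 ≤ t * v := by positivity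
  have hs : |t * e * v| ≤ 1/4 := by
    rw [mul_right_comm, abs_mul, hea, abs_of_nonneg htv0]; linarith
  obtain ⟨hexpInt, hle⟩ := gaussian_sq_mgf v (t * e) hs
  have hi' : iIndepFun (fun i ω => e * (Y i ω)^2) P :=
    hi.comp (fun _ x => e * x^2) (fun _ => by fun_prop)
  have hm' : ∀ i, Measurable (fun ω => e * (Y i ω)^2) := fun i => by have := hm i; fun_prop
  have hcomp : ∀ i, (fun ω => Real.exp (t * (e * (Y i ω)^2))) =
      (fun y => Real.exp (t * e * y^2)) ∘ (Y i) := by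
    intro i; ext ω; simp [mul_assoc]
  have hint1 : ∀ i, Integrable (fun ω => Real.exp (t * (e * (Y i ω)^2))) P := by
    intro i
    rw [hcomp i, ← integrable_map_measure (by fun_prop) (hm i).aemeasurable, hl i]
    exact hexpInt
  have hmgf : ∀ i, mgf (fun ω => e * (Y i ω)^2) P t ≤ Real.exp (t * e * v + 2 * (t * e * v)^2) := by
    intro i
    rw [mgf, hcomp i]
    have := integral_map (μ := P) (hm i).aemeasurable
      (f := fun y => Real.exp (t * e * y^2)) (by fun_prop)
    simp only [Function.comp_def]
    rw [← this, hl i]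
    exact hle
  have hint2 := hi'.integrable_exp_mul_sum (t := t) hm' (s := Finset.univ) (fun i _ => hint1 i)
  have hch := measure_ge_le_exp_mul_mgf (μ := P) (X := ∑ i, fun ω => e * (Y i ω)^2)
    (n * L * τ + e * (n * v)) ht0 hint2
  have hset : {ω | n * L * τ ≤ e * (∑ i, (Y i ω)^2 - n * v)} =
      {ω | n * L * τ + e * (n * v) ≤ (∑ i, fun ω => e * (Y i ω)^2) ω} := by
    ext ω
    simp only [Set.mem_ofPred_eq, Finset.sum_apply, ← Finset.mul_sum]
    rw [mul_sub]
    constructor <;> intro h <;> linarith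
  rw [hset]
  refine hch.trans ?_
  rw [hi'.mgf_sum hm']
  have hprod : ∏ i : Fin n, mgf (fun ω => e * (Y i ω)^2) P t ≤
      Real.exp (t * e * v + 2 * (t * e * v)^2) ^ n := by
    refine (Finset.prod_le_prod (fun i _ => mgf_nonneg) (fun i _ => hmgf i)).trans ?_
    simp
  refine (mul_le_mul_of_nonneg_left hprod (Real.exp_pos _).le).trans ?_
  rw [← Real.exp_nat_mul, ← Real.exp_add]
  apply Real.exp_le_exp.2
  have h1 : t * L = τ / 4 := by rw [ht]; field_simp
  have h2 : (t * e * v)^2 = (t * v)^2 := by rw [mul_right_comm, mul_pow, he, mul_one]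
  have h3 : (t * v)^2 ≤ (τ/4)^2 := by gcongr
  have hn : (0:ℝ) ≤ n := by positivity
  rw [h2]
  have h4 := mul_le_mul_of_nonneg_left h3 hn
  have h5 : -t * (n * L * τ + e * (n * v)) + n * (t * e * v + 2 * (t * v)^2) =
    -(n * (t * L) * τ) + 2 * (n * (t*v)^2) := by ring
  rw [h5, h1]
  nlinarith

lemma tail_two {n : ℕ} {Ω : Type*} [MeasurableSpace Ω] {P : Measure Ω}
    {Y : Fin n → Ω → ℝ} (hm : ∀ i, Measurable (Y i)) (hi : iIndepFun Y P) (v : NNReal)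
    (hl : ∀ i, P.map (Y i) = gaussianReal 0 v) (L τ : ℝ) (hL : 0 < L) (hv : (v : ℝ) ≤ L)
    (hτ : 0 ≤ τ) (hτ1 : τ ≤ 1) :
    P.real {ω | n * L * τ ≤ |∑ i, (Y i ω)^2 - n * v|} ≤ 2 * Real.exp (-(n * τ^2 / 8)) := by
  have hP := hi.isProbabilityMeasure
  have h1 := tail_one hm hi v hl L τ 1 hL hv hτ hτ1 (by norm_num)
  have h2 := tail_one hm hi v hl L τ (-1) hL hv hτ hτ1 (by norm_num)
  have : {ω | n * L * τ ≤ |∑ i, (Y i ω)^2 - n * v|} ⊆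
    {ω | n * L * τ ≤ 1 * (∑ i, (Y i ω)^2 - n * v)} ∪
    {ω | n * L * τ ≤ (-1) * (∑ i, (Y i ω)^2 - n * v)} := by
    intro ω h
    simp only [Set.mem_ofPred_eq, Set.mem_union] at h ⊢
    rcases le_abs.1 h with h | h
    · left; linarith
    · right; linarith
  refine (measureReal_mono this).trans ((measureReal_union_le _ _).trans ?_)
  linarith

lemma quad_eq {d n : ℕ} {Ω : Type*} (x : Fin n → Ω → Fin d → ℝ) (ω : Ω) (lam : ℝ)
    (vstar w : Fin d → ℝ) :
    quad (sampleCov x ω - spikedCov lam vstar) w =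
      (n : ℝ)⁻¹ * ∑ i, (ip (x i ω) w)^2 - (lam * (ip vstar w)^2 + ∑ i, w i ^ 2) := by
  have e : ∀ y z : Fin d → ℝ, ip y z = y ⬝ᵥ z := fun _ _ => rfl
  simp only [quad, sampleCov, spikedCov, e, sub_mulVec, add_mulVec, smul_mulVec, sum_mulVec,
    vecMulVec_mulVec, one_mulVec, dotProduct_sub, dotProduct_add, dotProduct_smul,
    dotProduct_sum]
  simp only [smul_eq_mul, MulOpposite.smul_eq_mul_unop, MulOpposite.unop_op]
  congr 2
  · congr 1
    funext i
    rw [dotProduct_comm w, sq]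
  · simp [dotProduct_comm w vstar, sq]
  · simp [dotProduct, sq]

lemma wishart_tail {d n : ℕ} (hn : 1 ≤ n) {Ω : Type*} [MeasurableSpace Ω] (P : Measure Ω)
    (lam : ℝ) (hlam : 0 < lam) (vstar : Fin d → ℝ) (hvs : nrm vstar = 1)
    (x : Fin n → Ω → Fin d → ℝ) (hx : IsSpikedWishart P lam vstar x)
    (w : Fin d → ℝ) (hw : ∑ i, w i ^ 2 ≤ 4) (τ : ℝ) (hτ : 0 ≤ τ) (hτ1 : τ ≤ 1) :
    P.real {ω | 4 * (1 + lam) * τ ≤ |quad (sampleCov x ω - spikedCov lam vstar) w|} ≤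
      2 * Real.exp (-(n * τ^2 / 8)) := by
  obtain ⟨G, hGm, hGi, hGl, hxG⟩ := hx
  let f : (_ : Fin n) × Option (Fin d) → Fin n ⊕ Fin n × Fin d := fun p =>
    match p.2 with
    | none => Sum.inl p.1
    | some j => Sum.inr (p.1, j)
  have hf : Function.Injective f := by
    rintro ⟨i, _ | j⟩ ⟨i', _ | j'⟩ h <;> simp [f] at h <;> simp [h]
  let X : Fin n → Option (Fin d) → Ω → ℝ := fun i o => G (f ⟨i, o⟩)
  have hXm : ∀ i j, Measurable (X i j) := fun i j => hGm _
  have hXi : iIndepFun (fun p : (_ : Fin n) × Option (Fin d) => X p.1 p.2) P := hGi.precomp hf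
  have hblock := block_indep hXm hXi
  let a : Option (Fin d) → ℝ := fun o =>
    match o with
    | none => √lam * ip vstar w
    | some j => w j
  let Y : Fin n → Ω → ℝ := fun i ω => ∑ o, a o * X i o ω
  have hYm : ∀ i, Measurable (Y i) := fun i =>
    Finset.measurable_sum _ (fun o _ => (hXm i o).const_mul _)
  have hYi : iIndepFun Y P :=
    hblock.comp (fun _ z => ∑ o, a o * z o) (fun _ => by fun_prop)
  have hYl : ∀ i, P.map (Y i) = gaussianReal 0 (∑ o, a o ^ 2).toNNReal := fun i =>
    map_lin_comb (hXm i) (hXi.precomp (g := fun j => (⟨i, j⟩ : (_ : Fin n) × Option (Fin d)))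
      (by intro a b; simp)) (fun j => hGl _) a Finset.univ
  have hYx : ∀ i ω, Y i ω = ip (x i ω) w := by
    intro i ω
    simp only [Y, Fintype.sum_option, a, X, f, ip, hxG, add_mul, Finset.sum_add_distrib,
      Finset.mul_sum, Finset.sum_mul]
    congr 1
    · apply Finset.sum_congr rfl; intros; ring
    · apply Finset.sum_congr rfl; intros; ring
  have hva : ∑ o, a o ^ 2 = lam * (ip vstar w)^2 + ∑ i, w i ^ 2 := by
    simp only [Fintype.sum_option, a, mul_pow, Real.sq_sqrt hlam.le]
  have hvs' : ∑ i, vstar i ^ 2 = 1 := by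
    unfold nrm at hvs
    simpa using hvs
  have hcs : (ip vstar w)^2 ≤ ∑ i, w i ^ 2 := by
    have := Finset.sum_mul_sq_le_sq_mul_sq Finset.univ vstar w
    rw [hvs', one_mul] at this
    exact this
  have hvL : ((∑ o, a o ^ 2).toNNReal : ℝ) ≤ 4 * (1 + lam) := by
    rw [Real.coe_toNNReal _ (Finset.sum_nonneg fun _ _ => sq_nonneg _), hva]
    nlinarith
  have key := tail_two hYm hYi _ hYl (4 * (1 + lam)) τ (by positivity) hvL hτ hτ1
  refine le_trans (le_of_eq ?_) key
  congr 1
  ext ω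
  have hn0 : (0:ℝ) < n := by exact_mod_cast hn
  simp only [Set.mem_ofPred_eq]
  rw [quad_eq, Real.coe_toNNReal _ (Finset.sum_nonneg fun _ _ => sq_nonneg _), hva]
  simp_rw [hYx]
  set S := ∑ i, (ip (x i ω) w)^2
  set V := lam * (ip vstar w)^2 + ∑ i, w i ^ 2
  have : S - n * V = n * ((n:ℝ)⁻¹ * S - V) := by field_simp
  rw [this, abs_mul, abs_of_pos hn0, mul_assoc (n:ℝ), mul_le_mul_iff_right₀ hn0]

lemma exists_net (E : Type*) [NormedAddCommGroup E] [NormedSpace ℝ E] [FiniteDimensional ℝ E] :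
    ∃ N : Finset E, N.card ≤ 5 ^ Module.finrank ℝ E ∧ (∀ c ∈ N, ‖c‖ ≤ 1) ∧
      ∀ x : E, ‖x‖ ≤ 1 → ∃ c ∈ N, ‖x - c‖ ≤ 1/2 := by
  classical
  let Q : ℕ → Prop := fun m => ∃ s : Finset E, s.card = m ∧ (∀ c ∈ s, ‖c‖ ≤ 2) ∧
    ∀ c ∈ s, ∀ d ∈ s, c ≠ d → 1 ≤ ‖c - d‖
  have hQ0 : Q 0 := ⟨∅, by simp⟩
  have hspec := Nat.findGreatest_spec (P := Q) (Nat.zero_le (5 ^ Module.finrank ℝ E)) hQ0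
  obtain ⟨s, hcard, hs2, hsep⟩ := hspec
  have hmax : ∀ x : E, ‖x‖ ≤ 2 → ∃ c ∈ s, ‖x - c‖ ≤ 1 := by
    intro x hx
    by_contra! hcon
    have hxs : x ∉ s := fun h => by have := hcon x h; simp at this; linarith
    have h2 : ∀ c ∈ insert x s, ‖c‖ ≤ 2 := by
      intro c hc
      rcases Finset.mem_insert.1 hc with rfl | h
      · exact hx
      · exact hs2 c h
    have h3 : ∀ c ∈ insert x s, ∀ d ∈ insert x s, c ≠ d → 1 ≤ ‖c - d‖ := by
      intro c hc e he hne
      rcases Finset.mem_insert.1 hc with rfl | h <;> rcases Finset.mem_insert.1 he with rfl | h'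
      · exact absurd rfl hne
      · exact (hcon _ h').le
      · rw [norm_sub_rev]; exact (hcon _ h).le
      · exact hsep _ h _ h' hne
    have hQ : Q (insert x s).card := ⟨_, rfl, h2, h3⟩
    have hb := Besicovitch.card_le_of_separated (insert x s) h2 h3
    have := Nat.le_findGreatest hb hQ
    rw [Finset.card_insert_of_notMem hxs, hcard] at this
    omega
  refine ⟨s.image (fun c => (1/2 : ℝ) • c), ?_, ?_, ?_⟩
  · refine Finset.card_image_le.trans ?_
    exact Besicovitch.card_le_of_separated s hs2 hsep
  · intro c hc
    obtain ⟨c', h, rfl⟩ := Finset.mem_image.1 hc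
    have := hs2 c' h
    rw [norm_smul]; norm_num; linarith
  · intro x hx
    obtain ⟨c, hc, h⟩ := hmax ((2:ℝ) • x) (by rw [norm_smul]; norm_num; linarith)
    refine ⟨_, Finset.mem_image_of_mem _ hc, ?_⟩
    have : x - (1/2 : ℝ) • c = (1/2:ℝ) • ((2:ℝ) • x - c) := by
      rw [smul_sub, smul_smul]; norm_num
    rw [this, norm_smul]; norm_num; linarith

lemma clm_net {E G : Type*} [NormedAddCommGroup E] [NormedSpace ℝ E] [NormedAddCommGroup G]
    [NormedSpace ℝ G] {N : Finset E} (hN : ∀ x : E, ‖x‖ ≤ 1 → ∃ c ∈ N, ‖x - c‖ ≤ 1/2)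
    (f : E →L[ℝ] G) (b : ℝ) (hb : 0 ≤ b) (hf : ∀ c ∈ N, ‖f c‖ ≤ b) : ‖f‖ ≤ 2 * b := by
  have : ‖f‖ ≤ b + ‖f‖ * (1/2) := by
    apply f.opNorm_le_of_unit_norm (by positivity)
    intro x hx
    obtain ⟨c, hc, h⟩ := hN x hx.le
    have e : f x = f c + f (x - c) := by simp
    rw [e]
    refine (norm_add_le _ _).trans (add_le_add (hf c hc) ((f.le_opNorm _).trans ?_))
    gcongr
  linarith

/-- Extension by zero. -/
def extz {d : ℕ} (F : Finset (Fin d)) : EuclideanSpace ℝ F →ₗ[ℝ] (Fin d → ℝ) where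
  toFun x i := if h : i ∈ F then x ⟨i, h⟩ else 0
  map_add' x y := by ext i; by_cases h : i ∈ F <;> simp [h]
  map_smul' c x := by ext i; by_cases h : i ∈ F <;> simp [h]

lemma sum_extz {d : ℕ} (F : Finset (Fin d)) (x : EuclideanSpace ℝ F) :
    ∑ i, (extz F x i)^2 = ‖x‖^2 := by
  rw [EuclideanSpace.norm_sq_eq, ← Finset.sum_subset (Finset.subset_univ F), ← Finset.sum_coe_sort F]
  · apply Finset.sum_congr rfl
    intro i _
    simp [extz]
  · intro i _ hi
    simp [extz, hi]

lemma ip_mulVec_symm {d : ℕ} {A : Matrix (Fin d) (Fin d) ℝ} (hA : Aᵀ = A) (u v : Fin d → ℝ) :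
    ip u (A *ᵥ v) = ip v (A *ᵥ u) := by
  change u ⬝ᵥ (A *ᵥ v) = v ⬝ᵥ (A *ᵥ u)
  rw [dotProduct_mulVec, ← mulVec_transpose, hA, dotProduct_comm]

lemma ip_add_left {d : ℕ} (u v w : Fin d → ℝ) : ip (u + v) w = ip u w + ip v w :=
  add_dotProduct u v w
lemma ip_sub_left {d : ℕ} (u v w : Fin d → ℝ) : ip (u - v) w = ip u w - ip v w :=
  sub_dotProduct u v w
lemma ip_add_right {d : ℕ} (u v w : Fin d → ℝ) : ip u (v + w) = ip u v + ip u w :=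
  dotProduct_add u v w
lemma ip_sub_right {d : ℕ} (u v w : Fin d → ℝ) : ip u (v - w) = ip u v - ip u w :=
  dotProduct_sub u v w
lemma ip_smul_left {d : ℕ} (c : ℝ) (u w : Fin d → ℝ) : ip (c • u) w = c * ip u w :=
  smul_dotProduct c u w
lemma ip_smul_right {d : ℕ} (c : ℝ) (u w : Fin d → ℝ) : ip u (c • w) = c * ip u w :=
  dotProduct_smul c u w

lemma exists_matrix_net {d : ℕ} (F : Finset (Fin d)) :
    ∃ N : Finset (Fin d → ℝ), N.card ≤ 2 * 25 ^ F.card ∧ (∀ w ∈ N, ∑ i, w i ^ 2 ≤ 4) ∧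
      ∀ A : Matrix (Fin d) (Fin d) ℝ, Aᵀ = A → ∀ b : ℝ, 0 ≤ b → (∀ w ∈ N, |quad A w| ≤ b) →
        ∀ u v : Fin d → ℝ, (∀ i, u i ≠ 0 → i ∈ F) → (∀ i, v i ≠ 0 → i ∈ F) →
          |ip u (A *ᵥ v)| ≤ 2 * b * nrm u * nrm v := by
  classical
  obtain ⟨N, hcard, hN1, hN⟩ := exists_net (EuclideanSpace ℝ F)
  rw [finrank_euclideanSpace, Fintype.card_coe] at hcard
  refine ⟨(N ×ˢ N).image (fun p => extz F (p.1 + p.2)) ∪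
    (N ×ˢ N).image (fun p => extz F (p.1 - p.2)), ?_, ?_, ?_⟩
  · refine (Finset.card_union_le _ _).trans ?_
    have h1 : (N ×ˢ N).card ≤ 25 ^ F.card := by
      rw [Finset.card_product, show 25 = 5 * 5 by norm_num, mul_pow]
      gcongr
    have h2 := (Finset.card_image_le (s := N ×ˢ N) (f := fun p => extz F (p.1 + p.2))).trans h1
    have h3 := (Finset.card_image_le (s := N ×ˢ N) (f := fun p => extz F (p.1 - p.2))).trans h1
    omega
  · intro w hw
    have key : ∃ x : EuclideanSpace ℝ F, ‖x‖ ≤ 2 ∧ extz F x = w := by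
      rcases Finset.mem_union.1 hw with h | h <;> obtain ⟨p, hp, rfl⟩ := Finset.mem_image.1 h <;>
        have hp1 := hN1 _ (Finset.mem_product.1 hp).1 <;>
        have hp2 := hN1 _ (Finset.mem_product.1 hp).2
      · exact ⟨_, (norm_add_le _ _).trans (by linarith), rfl⟩
      · exact ⟨_, (norm_sub_le _ _).trans (by linarith), rfl⟩
    obtain ⟨x, hx, rfl⟩ := key
    rw [sum_extz]
    nlinarith [norm_nonneg x]
  · intro A hA b hb hq u v hu hv
    let B0 : EuclideanSpace ℝ F →ₗ[ℝ] EuclideanSpace ℝ F →ₗ[ℝ] ℝ :=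
      LinearMap.mk₂ ℝ (fun x y => ip (extz F x) (A *ᵥ extz F y))
        (by intros; simp [ip_add_left]) (by intros; simp [ip_smul_left])
        (by intros; simp [mulVec_add, ip_add_right]) (by intros; simp [mulVec_smul, ip_smul_right])
    let B1 : EuclideanSpace ℝ F →ₗ[ℝ] (EuclideanSpace ℝ F →L[ℝ] ℝ) :=
      (LinearMap.toContinuousLinearMap (𝕜 := ℝ) (E := EuclideanSpace ℝ F) (F' := ℝ)).toLinearMap ∘ₗ B0
    let B : EuclideanSpace ℝ F →L[ℝ] (EuclideanSpace ℝ F →L[ℝ] ℝ) :=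
      LinearMap.toContinuousLinearMap B1
    have hB : ∀ x y, B x y = ip (extz F x) (A *ᵥ extz F y) := fun x y => rfl
    have hpair : ∀ c ∈ N, ∀ c' ∈ N, ‖B c c'‖ ≤ b / 2 := by
      intro c hc c' hc'
      rw [hB, Real.norm_eq_abs]
      have hp : (c, c') ∈ N ×ˢ N := Finset.mem_product.2 ⟨hc, hc'⟩
      have h1 := hq _ (Finset.mem_union_left _ (Finset.mem_image_of_mem _ hp))
      have h2 := hq _ (Finset.mem_union_right _ (Finset.mem_image_of_mem _ hp))
      simp only [map_add, map_sub] at h1 h2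
      set p := extz F c
      set q := extz F c'
      have e : quad A (p + q) - quad A (p - q) = 4 * ip p (A *ᵥ q) := by
        simp only [quad, mulVec_add, mulVec_sub, ip_add_left, ip_add_right, ip_sub_left, ip_sub_right]
        rw [ip_mulVec_symm hA q p]; ring
      rw [abs_le] at h1 h2 ⊢
      constructor <;> linarith
    have hB1 : ‖B‖ ≤ 2 * (2 * (b / 2)) := by
      apply clm_net hN B _ (by positivity)
      intro c hc
      exact clm_net hN (B c) _ (by positivity) (hpair c hc)
    have hext : ∀ u : Fin d → ℝ, (∀ i, u i ≠ 0 → i ∈ F) →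
        ∃ x : EuclideanSpace ℝ F, extz F x = u ∧ ‖x‖ = nrm u := by
      intro u hu
      have e : extz F (WithLp.toLp 2 (fun i : F => u i)) = u := by
        ext i
        by_cases h : i ∈ F
        · simp [extz, h]
        · have : u i = 0 := by by_contra h'; exact h (hu i h')
          simp [extz, h, this]
      refine ⟨_, e, ?_⟩
      rw [nrm]
      conv_rhs => rw [← e]
      rw [sum_extz, Real.sqrt_sq (norm_nonneg _)]
    obtain ⟨x, rfl, hx⟩ := hext u hu
    obtain ⟨y, rfl, hy⟩ := hext v hv
    rw [← hB, ← hx, ← hy, ← Real.norm_eq_abs]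
    refine (B.le_opNorm₂ x y).trans ?_
    have : ‖B‖ ≤ 2 * b := by linarith
    gcongr

lemma tree_count (d k : ℕ) (TS : Finset (Finset ℕ)) (hTS : ∀ T ∈ TS, IsTreeSet d k T) :
    TS.card ≤ 2 ^ (2 * k + 1) := by
  classical
  let U := Finset.range (2 * d + 2)
  let Cl : Finset ℕ → Finset ℕ := fun T =>
    insert 1 (T.image (fun i => 2 * i) ∪ T.image (fun i => 2 * i + 1))
  have hCmem : ∀ T i, i ∈ Cl T ↔ i = 1 ∨ i / 2 ∈ T := by
    intro T i
    simp only [Cl, Finset.mem_insert, Finset.mem_union, Finset.mem_image]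
    constructor
    · rintro (h | ⟨a, ha, rfl⟩ | ⟨a, ha, rfl⟩)
      · left; exact h
      · right; rwa [show 2 * a / 2 = a by omega]
      · right; rwa [show (2 * a + 1) / 2 = a by omega]
    · rintro (h | h)
      · left; exact h
      · right
        rcases Nat.even_or_odd' i with ⟨a, rfl | rfl⟩
        · left; exact ⟨a, by rwa [show 2 * a / 2 = a by omega] at h, rfl⟩
        · right; exact ⟨a, by rwa [show (2 * a + 1) / 2 = a by omega] at h, rfl⟩
  have hTC : ∀ T ∈ TS, T ⊆ Cl T := by
    intro T hT i hi
    obtain ⟨_, h1, h2, h3⟩ := hTS T hT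
    rw [hCmem]
    by_cases h : 2 ≤ i
    · right; exact h3 i hi h
    · left; have := (h2 i hi).1; omega
  have hCcard : ∀ T ∈ TS, (Cl T).card ≤ 2 * k + 1 := by
    intro T hT
    have hk := (hTS T hT).1
    refine (Finset.card_insert_le _ _).trans ?_
    have := Finset.card_union_le (T.image (fun i => 2 * i)) (T.image (fun i => 2 * i + 1))
    have h1 := Finset.card_image_le (s := T) (f := fun i => 2 * i)
    have h2 := Finset.card_image_le (s := T) (f := fun i => 2 * i + 1)
    omega
  let Φ : Finset ℕ → Finset (Finset ℕ) := fun T => U.powerset.filter (fun S => S ∩ Cl T = T)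
  have hΦ : ∀ T ∈ TS, 2 ^ U.card ≤ (Φ T).card * 2 ^ (2 * k + 1) := by
    intro T hT
    have hTU : T ⊆ U := by
      intro i hi
      have := ((hTS T hT).2.2.1 i hi).2
      simp only [U, Finset.mem_range]; omega
    have h1 : (U \ Cl T).powerset.card ≤ (Φ T).card := by
      apply Finset.card_le_card_of_injOn (fun R => T ∪ R)
      · intro R hR
        have hR := Finset.mem_powerset.1 (Finset.mem_coe.1 hR)
        simp only [Φ, Finset.coe_filter, Finset.mem_powerset, Set.mem_ofPred_eq]
        refine ⟨Finset.union_subset hTU (hR.trans Finset.sdiff_subset), ?_⟩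
        rw [Finset.union_inter_distrib_right, Finset.inter_eq_left.2 (hTC T hT)]
        have : R ∩ Cl T = ∅ := by
          rw [← Finset.disjoint_iff_inter_eq_empty]
          exact Finset.disjoint_of_subset_left hR Finset.sdiff_disjoint
        rw [this, Finset.union_empty]
      · intro R hR R' hR' h
        have hR := Finset.mem_powerset.1 (Finset.mem_coe.1 hR)
        have hR' := Finset.mem_powerset.1 (Finset.mem_coe.1 hR')
        have aux : ∀ R, R ⊆ U \ Cl T → (T ∪ R) \ T = R := by
          intro R hR
          rw [Finset.union_sdiff_left]
          apply Finset.sdiff_eq_self_of_disjoint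
          exact Finset.disjoint_of_subset_left hR
            (Finset.disjoint_of_subset_right (hTC T hT) Finset.sdiff_disjoint)
        simp only at h
        rw [← aux R hR, ← aux R' hR', h]
    rw [Finset.card_powerset] at h1
    have h2 : U.card ≤ (U \ Cl T).card + (2 * k + 1) := by
      have := Finset.le_card_sdiff (Cl T) U
      have := hCcard T hT
      omega
    calc 2 ^ U.card ≤ 2 ^ ((U \ Cl T).card + (2 * k + 1)) := Nat.pow_le_pow_right (by norm_num) h2
      _ = 2 ^ (U \ Cl T).card * 2 ^ (2 * k + 1) := pow_add _ _ _
      _ ≤ _ := by gcongr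
  have hdisj : Set.PairwiseDisjoint (TS : Set (Finset ℕ)) Φ := by
    intro T hT T' hT' hne
    rw [Function.onFun, Finset.disjoint_left]
    intro S hS hS'
    apply hne
    have hS := (Finset.mem_filter.1 hS).2
    have hS' := (Finset.mem_filter.1 hS').2
    have aux : ∀ T ∈ TS, ∀ T' ∈ TS, S ∩ Cl T = T → S ∩ Cl T' = T' → ∀ m, m ∈ T → m ∈ T' := by
      intro T hT T' hT' hS hS' m
      induction m using Nat.strong_induction_on with
      | _ m ih =>
        intro hm
        have hmS : m ∈ S := by rw [← hS] at hm; exact (Finset.mem_inter.1 hm).1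
        rw [← hS', Finset.mem_inter, hCmem]
        refine ⟨hmS, ?_⟩
        by_cases h : 2 ≤ m
        · right
          exact ih (m / 2) (by omega) ((hTS T hT).2.2.2 m hm h)
        · left
          have := ((hTS T hT).2.2.1 m hm).1
          omega
    ext m
    exact ⟨aux T hT T' hT' hS hS' m, aux T' hT' T hT hS' hS m⟩
  have hsum : ∑ T ∈ TS, (Φ T).card ≤ 2 ^ U.card := by
    rw [← Finset.card_biUnion hdisj, ← Finset.card_powerset]
    apply Finset.card_le_card
    intro S hS
    obtain ⟨T, _, h⟩ := Finset.mem_biUnion.1 hS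
    exact (Finset.mem_filter.1 h).1
  have h3 : TS.card * 2 ^ U.card ≤ 2 ^ (2 * k + 1) * 2 ^ U.card := by
    calc TS.card * 2 ^ U.card = ∑ T ∈ TS, 2 ^ U.card := by simp
      _ ≤ ∑ T ∈ TS, (Φ T).card * 2 ^ (2 * k + 1) := Finset.sum_le_sum hΦ
      _ = (∑ T ∈ TS, (Φ T).card) * 2 ^ (2 * k + 1) := by rw [Finset.sum_mul]
      _ ≤ 2 ^ U.card * 2 ^ (2 * k + 1) := by gcongr
      _ = _ := mul_comm _ _
  exact Nat.le_of_mul_le_mul_right h3 (by positivity)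

lemma nrm_sq {d : ℕ} (v : Fin d → ℝ) : nrm v ^ 2 = ip v v := by
  rw [nrm, Real.sq_sqrt (Finset.sum_nonneg fun _ _ => sq_nonneg _)]
  simp [ip, sq]

lemma nrm_nonneg {d : ℕ} (v : Fin d → ℝ) : 0 ≤ nrm v := Real.sqrt_nonneg _

lemma ip_comm {d : ℕ} (u v : Fin d → ℝ) : ip u v = ip v u := dotProduct_comm u v

lemma spiked_quad {d : ℕ} (lam : ℝ) (vstar w : Fin d → ℝ) :
    quad (spikedCov lam vstar) w = lam * (ip vstar w)^2 + ip w w := by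
  have e : ∀ y z : Fin d → ℝ, ip y z = y ⬝ᵥ z := fun _ _ => rfl
  simp only [quad, spikedCov, e, add_mulVec, smul_mulVec,
    vecMulVec_mulVec, one_mulVec, dotProduct_add, dotProduct_smul]
  simp [dotProduct_comm w vstar, sq]

lemma quad_sub {d : ℕ} (A B : Matrix (Fin d) (Fin d) ℝ) (w : Fin d → ℝ) :
    quad (A - B) w = quad A w - quad B w := by
  simp only [quad, sub_mulVec, ip_sub_right]

lemma cov_symm {d n : ℕ} {Ω : Type*} (x : Fin n → Ω → Fin d → ℝ) (ω : Ω) (lam : ℝ)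
    (vstar : Fin d → ℝ) :
    (sampleCov x ω - spikedCov lam vstar)ᵀ = sampleCov x ω - spikedCov lam vstar := by
  simp [sampleCov, spikedCov, transpose_sum, transpose_vecMulVec]

lemma deterministic {d : ℕ} (S : Matrix (Fin d) (Fin d) ℝ) (lam : ℝ) (hlam : 0 < lam)
    (vs vh : Fin d → ℝ) (hvs : nrm vs = 1) (hvh : nrm vh = 1) (hip : 0 ≤ ip vs vh)
    (hA : (S - spikedCov lam vs)ᵀ = S - spikedCov lam vs)
    (hmax : quad S vs ≤ quad S vh) (b : ℝ)
    (hb : |ip (vh - vs) ((S - spikedCov lam vs) *ᵥ (vh + vs))| ≤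
      2 * b * nrm (vh - vs) * nrm (vh + vs)) (hb0 : 0 ≤ b) :
    nrm (vh - vs) ≤ 8 * b / lam := by
  set A := S - spikedCov lam vs with hAdef
  have e1 : ip (vh - vs) (A *ᵥ (vh + vs)) = quad A vh - quad A vs := by
    simp only [quad, mulVec_add, ip_add_right, ip_sub_left]
    rw [ip_mulVec_symm hA vh vs]; ring
  have hss : ip vs vs = 1 := by rw [← nrm_sq, hvs]; norm_num
  have hhh : ip vh vh = 1 := by rw [← nrm_sq, hvh]; norm_num
  have e2 : lam * (1 - (ip vs vh)^2) ≤ quad A vh - quad A vs := by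
    rw [hAdef, quad_sub, quad_sub, spiked_quad, spiked_quad, hss, hhh]
    nlinarith
  have hu : nrm (vh - vs) ^ 2 = 2 - 2 * ip vs vh := by
    rw [nrm_sq]; simp only [ip_sub_left, ip_sub_right, hss, hhh, ip_comm vh vs]; ring
  have hv : nrm (vh + vs) ^ 2 = 2 + 2 * ip vs vh := by
    rw [nrm_sq]; simp only [ip_add_left, ip_add_right, hss, hhh, ip_comm vh vs]; ring
  have hu0 := nrm_nonneg (vh - vs)
  have hv0 := nrm_nonneg (vh + vs)
  have h3 := (le_abs_self _).trans hb
  rw [e1] at h3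
  set p := nrm (vh - vs)
  set q := nrm (vh + vs)
  have hq : 1 ≤ q := by nlinarith
  have e3 : 1 - (ip vs vh)^2 = p^2 * q^2 / 4 := by rw [hu, hv]; ring
  have h4 : lam * (p^2 * q^2 / 4) ≤ 2 * b * p * q := by rw [← e3]; linarith
  rw [le_div_iff₀ hlam]
  rcases hu0.eq_or_lt with h | h
  · rw [← h]; simp; positivity
  · have hpq : 0 < p * q := by positivity
    have h5 : (lam * (p * q)) * (p * q) ≤ (8 * b) * (p * q) := by nlinarith
    have h6 := le_of_mul_le_mul_right h5 hpq
    nlinarith [mul_nonneg (mul_nonneg hlam.le hu0) (sub_nonneg.2 hq)]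

lemma trivial_bound {d : ℕ} (vs vh : Fin d → ℝ) (hvs : nrm vs = 1) (hvh : nrm vh = 1)
    (hip : 0 ≤ ip vs vh) : nrm (vh - vs) ≤ 2 := by
  have hss : ip vs vs = 1 := by rw [← nrm_sq, hvs]; norm_num
  have hhh : ip vh vh = 1 := by rw [← nrm_sq, hvh]; norm_num
  have hu : nrm (vh - vs) ^ 2 = 2 - 2 * ip vs vh := by
    rw [nrm_sq]; simp only [ip_sub_left, ip_sub_right, hss, hhh, ip_comm vh vs]; ring
  nlinarith [nrm_nonneg (vh - vs)]

lemma union_numeric (k : ℕ) (hk : 1 ≤ k) (c1 : ℝ) :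
    (2:ℝ) ^ (2 * k + 1) * (2 * 25 ^ (2 * k)) *
      (2 * Real.exp (-(8 * ((3 + Real.log 2 + c1) * k)))) ≤ 2 * Real.exp (-(8 * c1 * k)) := by
  have hlog : 0 ≤ Real.log 2 := Real.log_nonneg (by norm_num)
  have h1 : (2:ℝ) ^ (2 * k + 1) * (2 * 25 ^ (2 * k)) = 4 * 2500 ^ k := by
    rw [pow_succ, pow_mul, pow_mul, show (2500:ℝ) = 2^2 * 25^2 by norm_num, mul_pow]; ring
  have h2 : (4:ℝ) * 2500 ^ k ≤ Real.exp (24 * k) := by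
    have h4 : (4:ℝ) ≤ 4 ^ k := le_self_pow₀ (by norm_num) (by omega)
    have he : (10000:ℝ) ≤ Real.exp 24 := by
      have := Real.add_one_le_exp (1:ℝ)
      have h : (2:ℝ)^24 ≤ Real.exp 1 ^ 24 := by gcongr; linarith
      rw [← Real.exp_nat_mul] at h
      norm_num at h ⊢
      linarith
    calc (4:ℝ) * 2500 ^ k ≤ 4 ^ k * 2500 ^ k := by gcongr
      _ = 10000 ^ k := by rw [← mul_pow]; norm_num
      _ ≤ Real.exp 24 ^ k := by gcongr
      _ = Real.exp (24 * k) := by rw [← Real.exp_nat_mul]; congr 1; ring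
  rw [h1]
  calc 4 * (2500:ℝ) ^ k * (2 * Real.exp (-(8 * ((3 + Real.log 2 + c1) * k))))
      ≤ Real.exp (24 * k) * (2 * Real.exp (-(8 * ((3 + Real.log 2 + c1) * k)))) := by gcongr
    _ = 2 * Real.exp (24 * k + -(8 * ((3 + Real.log 2 + c1) * k))) := by rw [Real.exp_add]; ring
    _ ≤ _ := by
      gcongr
      nlinarith [mul_nonneg hlog (Nat.cast_nonneg (α := ℝ) k)]

lemma card_support {d : ℕ} (T : Finset ℕ) :
    (Finset.univ.filter (fun i : Fin d => (i : ℕ) + 1 ∈ T)).card ≤ T.card := by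
  apply Finset.card_le_card_of_injOn (fun i : Fin d => (i : ℕ) + 1)
  · intro i hi
    simpa using hi
  · intro i _ j _ h
    ext
    simpa using h

lemma exists_bad_event {d k n : ℕ} (hn : 1 ≤ n) (lam : ℝ) (hlam : 0 < lam)
    (vstar : Fin d → ℝ) (hsp : TreeSparse d k vstar) (hvs : nrm vstar = 1)
    {Ω : Type*} [MeasurableSpace Ω] (P : Measure Ω) [IsProbabilityMeasure P]
    (x : Fin n → Ω → Fin d → ℝ) (hx : IsSpikedWishart P lam vstar x) (c1 τ : ℝ) (hc1 : 0 < c1)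
    (hτ : 0 ≤ τ) (hτ1 : τ ≤ 1) (hτ2 : n * τ^2 / 8 = 8 * ((3 + Real.log 2 + c1) * k)) :
    ∃ Bad : Set Ω, P.real Bad ≤ 2 * Real.exp (-(c1 * k)) ∧ ∀ ω, ω ∉ Bad →
      ∀ vh : Fin d → ℝ, TreeSparse d k vh →
        |ip (vh - vstar) ((sampleCov x ω - spikedCov lam vstar) *ᵥ (vh + vstar))| ≤
          2 * (4 * (1 + lam) * τ) * nrm (vh - vstar) * nrm (vh + vstar) := by
  classical
  obtain ⟨Ts, hTs, hsupp⟩ := hsp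
  have hk : 1 ≤ k := by
    rw [← hTs.1]; exact Finset.card_pos.2 ⟨1, hTs.2.1⟩
  let TS := (Finset.range (d + 1)).powerset.filter (fun T => IsTreeSet d k T)
  have hTS : ∀ T ∈ TS, IsTreeSet d k T := fun T hT => (Finset.mem_filter.1 hT).2
  have hcount := tree_count d k TS hTS
  let F : Finset ℕ → Finset (Fin d) := fun T =>
    Finset.univ.filter (fun i : Fin d => (i : ℕ) + 1 ∈ T) ∪
      Finset.univ.filter (fun i : Fin d => (i : ℕ) + 1 ∈ Ts)
  have hF : ∀ T ∈ TS, (F T).card ≤ 2 * k := by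
    intro T hT
    have h1 := Finset.card_union_le (Finset.univ.filter (fun i : Fin d => (i : ℕ) + 1 ∈ T))
      (Finset.univ.filter (fun i : Fin d => (i : ℕ) + 1 ∈ Ts))
    have h2 := card_support (d := d) T
    have h3 := card_support (d := d) Ts
    have h4 := (hTS T hT).1
    have h5 := hTs.1
    simp only [F]
    omega
  choose N hNcard hN4 hN using fun T => exists_matrix_net (F T)
  refine ⟨⋃ T ∈ TS, ⋃ w ∈ N T,
    {ω | 4 * (1 + lam) * τ ≤ |quad (sampleCov x ω - spikedCov lam vstar) w|}, ?_, ?_⟩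
  · have hw : ∀ T ∈ TS, P.real (⋃ w ∈ N T,
        {ω | 4 * (1 + lam) * τ ≤ |quad (sampleCov x ω - spikedCov lam vstar) w|}) ≤
        (2 * 25 ^ (2 * k)) * (2 * Real.exp (-(8 * ((3 + Real.log 2 + c1) * k)))) := by
      intro T hT
      refine (measureReal_biUnion_finset_le _ _).trans ?_
      refine (Finset.sum_le_card_nsmul _ _ _ (fun w hw =>
        wishart_tail hn P lam hlam vstar hvs x hx w (hN4 T w hw) τ hτ hτ1)).trans ?_
      rw [nsmul_eq_mul, hτ2]
      gcongr
      have h1 : (N T).card ≤ 2 * 25 ^ (2 * k) :=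
        (hNcard T).trans (by gcongr; exacts [by norm_num, hF T hT])
      exact_mod_cast h1
    refine (measureReal_biUnion_finset_le _ _).trans ?_
    refine (Finset.sum_le_card_nsmul _ _ _ hw).trans ?_
    rw [nsmul_eq_mul]
    have h1 : (TS.card : ℝ) ≤ 2 ^ (2 * k + 1) := by exact_mod_cast hcount
    calc _ ≤ (2:ℝ) ^ (2 * k + 1) * ((2 * 25 ^ (2 * k)) *
          (2 * Real.exp (-(8 * ((3 + Real.log 2 + c1) * k))))) := by gcongr
      _ ≤ 2 * Real.exp (-(8 * c1 * k)) := by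
          rw [← mul_assoc]; exact union_numeric k hk c1
      _ ≤ _ := by
          gcongr
          nlinarith [mul_nonneg hc1.le (Nat.cast_nonneg (α := ℝ) k)]
  · intro ω hω vh hvh
    obtain ⟨T, hT, hTsupp⟩ := hvh
    have hTmem : T ∈ TS := by
      refine Finset.mem_filter.2 ⟨Finset.mem_powerset.2 ?_, hT⟩
      intro i hi
      have := (hT.2.2.1 i hi).2
      simp only [Finset.mem_range]; omega
    simp only [Set.mem_iUnion, not_exists, Set.mem_ofPred_eq, not_le] at hω
    have hsub : ∀ i, (vh i ≠ 0 ∨ vstar i ≠ 0) → i ∈ F T := by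
      intro i hi
      simp only [F, Finset.mem_union, Finset.mem_filter, Finset.mem_univ, true_and]
      exact hi.imp (hTsupp i) (hsupp i)
    apply hN T _ (cov_symm x ω lam vstar) _ (by positivity) (fun w hw => (hω T hTmem w hw).le)
    · intro i hi
      apply hsub
      by_contra! h
      apply hi; simp [h.1, h.2]
    · intro i hi
      apply hsub
      by_contra! h
      apply hi; simp [h.1, h.2]

/-- Corollary 5(a): high-probability error bound for the
exhaustive-search estimator in tree-sparse PCA. -/
theorem tree_sparse_exhaustive_upper_bound :
    ∃ C : ℝ, 0 < C ∧
      ∀ (h d k n : ℕ), d = 2 ^ h - 1 → 1 ≤ n →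
      ∀ lam : ℝ, 0 < lam →
      ∀ vstar : Fin d → ℝ, TreeSparse d k vstar → nrm vstar = 1 →
      ∀ (Ω : Type) (_ : MeasurableSpace Ω) (μ : Measure Ω), IsProbabilityMeasure μ →
      ∀ x : Fin n → Ω → Fin d → ℝ, IsSpikedWishart μ lam vstar x →
      ∀ vhat : Ω → Fin d → ℝ,
        (∀ ω, TreeSparse d k (vhat ω) ∧ nrm (vhat ω) = 1 ∧
          (∀ u : Fin d → ℝ, TreeSparse d k u → nrm u = 1 →
            quad (sampleCov x ω) u ≤ quad (sampleCov x ω) (vhat ω)) ∧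
          0 ≤ ip vstar (vhat ω)) →
      ∀ c1 : ℝ, 0 < c1 →
        ENNReal.ofReal (1 - 2 * Real.exp (-(c1 * k))) ≤
          μ {ω | nrm (vhat ω - vstar) ≤
            C * ((1 + lam) / lam) * Real.sqrt ((3 + Real.log 2 + c1) * k / n)} := by
  refine ⟨256, by norm_num, ?_⟩
  intro h d k n hd hn lam hlam vstar hsp hvs Ω _ μ hμ x hx vhat hvhat c1 hc1
  have hlog : 0 ≤ Real.log 2 := Real.log_nonneg (by norm_num)
  have hn0 : (0:ℝ) < n := by exact_mod_cast hn
  set t : ℝ := (3 + Real.log 2 + c1) * k / n with ht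
  have ht0 : 0 ≤ t := by positivity
  set τ : ℝ := 8 * √t with hτ
  have hτ0 : 0 ≤ τ := by positivity
  have hrhs : 256 * ((1 + lam) / lam) * √t = 32 * ((1 + lam) / lam) * τ := by rw [hτ]; ring
  rw [hrhs]
  have hratio : 1 ≤ (1 + lam) / lam := by rw [le_div_iff₀ hlam]; linarith
  have hmain : ∃ Bad : Set Ω, μ.real Bad ≤ 2 * Real.exp (-(c1 * k)) ∧ ∀ ω, ω ∉ Bad →
      nrm (vhat ω - vstar) ≤ 32 * ((1 + lam) / lam) * τ := by
    rcases le_total τ 1 with hτ1 | hτ1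
    · have hτ2 : n * τ^2 / 8 = 8 * ((3 + Real.log 2 + c1) * k) := by
        rw [hτ, mul_pow, Real.sq_sqrt ht0, ht]; field_simp
      obtain ⟨Bad, hB, hgood⟩ := exists_bad_event hn lam hlam vstar hsp hvs μ x hx c1 τ hc1
        hτ0 hτ1 hτ2
      refine ⟨Bad, hB, fun ω hω => ?_⟩
      obtain ⟨h1, h2, h3, h4⟩ := hvhat ω
      have := deterministic (sampleCov x ω) lam hlam vstar (vhat ω) hvs h2 h4
        (cov_symm x ω lam vstar) (h3 vstar hsp hvs) (4 * (1 + lam) * τ) (hgood ω hω _ h1)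
        (by positivity)
      refine this.trans (le_of_eq ?_)
      ring
    · refine ⟨∅, by simp; positivity, fun ω _ => ?_⟩
      obtain ⟨h1, h2, h3, h4⟩ := hvhat ω
      have := trivial_bound vstar (vhat ω) hvs h2 h4
      nlinarith
  obtain ⟨Bad, hB, hgood⟩ := hmain
  have hB' : μ Bad ≤ ENNReal.ofReal (2 * Real.exp (-(c1 * k))) := by
    rw [← ofReal_measureReal]
    exact ENNReal.ofReal_le_ofReal hB
  rw [ENNReal.ofReal_sub _ (by positivity), ENNReal.ofReal_one, tsub_le_iff_right, ← measure_univ (μ := μ)]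
  refine (measure_mono (t := {ω | nrm (vhat ω - vstar) ≤ 32 * ((1 + lam) / lam) * τ} ∪ Bad) ?_).trans
    ((measure_union_le _ _).trans (add_le_add le_rfl hB'))
  intro ω _
  by_cases hω : ω ∈ Bad
  · exact Or.inr hω
  · exact Or.inl (hgood ω hω)

end StructuredPCA
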